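/- arXiv:1811.11608 — 3 statements merged into one kernel-verified Lean document; each statement's English description precedes it below -/
import Mathlib

section
/- For every complex number $z$ with $1<\operatorname{Re} z<2$ and every real $r\ne 0$ one has $\int_{-\infty}^\infty (1+\eta^2)^{-z/2}\, e^{i\eta r}\, d\eta \;=\; \frac{2\pi e^{-|r|}}{2^{z/2}\,\Gamma(z/2)\,\Gamma(1-z/2)}\, \int_0^\infty e^{-|r|\tau}\,\big(\tau+\tau^2/2\big)^{-z/2}\, d\tau$, where both integrals converge absolutely. -/
open MeasureTheory

open Set FourierTransform

theorem integrableOn_cpow_mul_exp_neg_mul_Ioi {a : ℂ} {r : ℝ} (ha : 0 < a.re) (hr : 0 < r) :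
    IntegrableOn (fun t : ℝ => (t : ℂ) ^ (a - 1) * Complex.exp (-(r * t))) (Ioi 0) := by
  have hmeas : AEStronglyMeasurable
      (fun t : ℝ => (t : ℂ) ^ (a - 1) * Complex.exp (-(r * t))) (volume.restrict (Ioi 0)) := by
    apply Measurable.aestronglyMeasurable
    fun_prop
  have hreal : IntegrableOn (fun t : ℝ => t ^ (a.re - 1) * Real.exp (-(r * t))) (Ioi 0) := by
    refine Integrable.of_integral_ne_zero ?_
    rw [Real.integral_rpow_mul_exp_neg_mul_Ioi ha hr]
    have := Real.Gamma_pos_of_pos ha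
    positivity
  refine Integrable.mono' hreal hmeas ?_
  filter_upwards [ae_restrict_mem measurableSet_Ioi] with t ht
  rw [norm_mul, Complex.norm_cpow_eq_rpow_re_of_pos ht, Complex.norm_exp]
  simp

theorem integral_norm_cpow_mul_exp_neg_mul_Ioi {a : ℂ} {r : ℝ} (ha : 0 < a.re) (hr : 0 < r) :
    ∫ t : ℝ in Ioi 0, ‖(t : ℂ) ^ (a - 1) * Complex.exp (-(r * t))‖
      = (1 / r) ^ a.re * Real.Gamma a.re := by
  rw [← Real.integral_rpow_mul_exp_neg_mul_Ioi ha hr]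
  refine setIntegral_congr_fun measurableSet_Ioi fun t ht => ?_
  rw [norm_mul, Complex.norm_cpow_eq_rpow_re_of_pos ht, Complex.norm_exp]
  simp

theorem integrable_stieltjes_kernel {s : ℂ} {A : ℝ} (hs0 : 0 < s.re) (hs1 : s.re < 1)
    (hA : 0 < A) :
    Integrable (fun p : ℝ × ℝ => (p.2 : ℂ) ^ (-s) * Complex.exp (-(p.1 * p.2)) *
      Complex.exp (-(A * p.1)))
      ((volume.restrict (Ioi 0)).prod (volume.restrict (Ioi 0))) := by
  have h1s : 0 < (1 - s).re := by simpa using hs1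
  have hexp : (1 - s) - 1 = -s := by ring
  rw [integrable_prod_iff (by apply Measurable.aestronglyMeasurable; fun_prop)]
  constructor
  · filter_upwards [ae_restrict_mem measurableSet_Ioi] with t ht
    have := integrableOn_cpow_mul_exp_neg_mul_Ioi h1s ht
    rw [hexp] at this
    exact this.mul_const _
  · have := ((integrableOn_cpow_mul_exp_neg_mul_Ioi hs0 hA).norm).mul_const
      (Real.Gamma (1 - s).re)
    refine this.congr ?_
    filter_upwards [ae_restrict_mem measurableSet_Ioi] with t ht
    have ht' : 0 < t := ht
    have hn := integral_norm_cpow_mul_exp_neg_mul_Ioi h1s ht'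
    rw [hexp] at hn
    simp_rw [norm_mul _ (Complex.exp (-(A * _)))]
    rw [integral_mul_const, hn, Complex.norm_cpow_eq_rpow_re_of_pos ht']
    have : (1 / t) ^ (1 - s).re = t ^ (s - 1).re := by
      rw [one_div, Real.inv_rpow ht'.le, ← Real.rpow_neg ht'.le]
      simp
    rw [this]
    ring

theorem integral_exp_neg_mul_add {s : ℂ} {A v : ℝ} (hA : 0 < A) (hv : 0 < v) :
    ∫ t : ℝ in Ioi 0, (v : ℂ) ^ (-s) * Complex.exp (-(t * v)) * Complex.exp (-(A * t))
      = (v : ℂ) ^ (-s) / (v + A) := by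
  simp_rw [mul_assoc, ← Complex.exp_add]
  rw [integral_const_mul]
  have h := integral_exp_mul_complex_Ioi (a := -((v : ℂ) + A)) (by simp; linarith) 0
  have : ∀ t : ℝ, -((t : ℂ) * v) + -(A * t) = -((v : ℂ) + A) * t := fun t => by ring
  simp_rw [this]
  rw [h]
  rw [neg_div_neg_eq, Complex.ofReal_zero, mul_zero, Complex.exp_zero, mul_one_div]

theorem integrableOn_cpow_neg_div_add {s : ℂ} {A : ℝ} (hs0 : 0 < s.re) (hs1 : s.re < 1)
    (hA : 0 < A) :
    IntegrableOn (fun v : ℝ => (v : ℂ) ^ (-s) / (v + A)) (Ioi 0) := by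
  refine (integrable_stieltjes_kernel hs0 hs1 hA).integral_prod_right.congr ?_
  filter_upwards [ae_restrict_mem measurableSet_Ioi] with v hv
  exact integral_exp_neg_mul_add hA hv

theorem integral_cpow_neg_div_add {s : ℂ} {A : ℝ} (hs0 : 0 < s.re) (hs1 : s.re < 1)
    (hA : 0 < A) :
    ∫ v : ℝ in Ioi 0, (v : ℂ) ^ (-s) / (v + A)
      = (A : ℂ) ^ (-s) * (Complex.Gamma s * Complex.Gamma (1 - s)) := by
  have h1s : 0 < (1 - s).re := by simpa using hs1
  have hexp : (1 - s) - 1 = -s := by ring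
  have hinv : ∀ (x : ℝ) (w : ℂ), 0 < x → (1 / (x : ℂ)) ^ w = (x : ℂ) ^ (-w) := fun x w hx => by
    rw [one_div, Complex.inv_cpow _ _ (by rw [Complex.arg_ofReal_of_nonneg hx.le]; exact
      Real.pi_pos.ne), Complex.cpow_neg]
  have hswap := integral_integral_swap
    (f := fun t v : ℝ => (v : ℂ) ^ (-s) * Complex.exp (-(t * v)) * Complex.exp (-(A * t)))
    (integrable_stieltjes_kernel hs0 hs1 hA)
  rw [← setIntegral_congr_fun measurableSet_Ioi fun v hv => integral_exp_neg_mul_add hA hv,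
    ← hswap]
  calc _ = ∫ t : ℝ in Ioi 0, Complex.Gamma (1 - s) *
        ((t : ℂ) ^ (s - 1) * Complex.exp (-(A * t))) := by
        refine setIntegral_congr_fun measurableSet_Ioi fun t ht => ?_
        have h := Complex.integral_cpow_mul_exp_neg_mul_Ioi h1s ht
        rw [hexp] at h
        rw [integral_mul_const, h, hinv t _ ht, neg_sub]
        ring
    _ = _ := by
        rw [integral_const_mul, Complex.integral_cpow_mul_exp_neg_mul_Ioi hs0 hA, hinv A _ hA]
        ring

theorem integrable_inv_add_sq {a : ℝ} (ha : 0 < a) :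
    Integrable (fun η : ℝ => (((a ^ 2 + η ^ 2 : ℝ) : ℂ))⁻¹) := by
  have h := (integrable_inv_one_add_sq.comp_div ha.ne').const_mul (a ^ 2)⁻¹
  have h2 := h.ofReal (𝕜 := ℂ)
  refine h2.congr (Filter.Eventually.of_forall fun η => ?_)
  simp only [RCLike.ofReal_eq_complex_ofReal]
  rw [← Complex.ofReal_inv, ← mul_inv]
  congr 2
  field_simp

theorem integrable_exp_neg_mul_abs {a : ℝ} (ha : 0 < a) :
    Integrable (fun x : ℝ => Complex.exp (-(a * |x| : ℝ))) := by
  rw [← integrableOn_univ, ← Iic_union_Ioi (a := (0 : ℝ)), integrableOn_union]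
  constructor
  · refine (integrableOn_exp_mul_complex_Iic (a := a) (by simpa) 0).congr_fun
      (fun x hx => ?_) measurableSet_Iic
    simp [abs_of_nonpos (show x ≤ 0 from hx)]
  · refine (integrableOn_exp_mul_complex_Ioi (a := -a) (by simpa) 0).congr_fun
      (fun x hx => ?_) measurableSet_Ioi
    simp [abs_of_pos (show 0 < x from hx)]

theorem fourier_exp_neg_mul_abs {a : ℝ} (ha : 0 < a) (w : ℝ) :
    𝓕 (fun x : ℝ => Complex.exp (-(a * |x| : ℝ))) w
      = 2 * a * (((a ^ 2 + (2 * Real.pi * w) ^ 2 : ℝ) : ℂ))⁻¹ := by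
  set b : ℂ := 2 * Real.pi * w * Complex.I with hb
  have hbre : b.re = 0 := by simp [hb]
  have hleft : EqOn (fun x : ℝ => Complex.exp ((a - b) * x))
      (fun x : ℝ => Complex.exp (-(b * x)) * Complex.exp (-(a * |x| : ℝ))) (Iic 0) := by
    intro x hx
    simp only [← Complex.exp_add, abs_of_nonpos (show x ≤ 0 from hx)]
    push_cast
    ring_nf
  have hright : EqOn (fun x : ℝ => Complex.exp ((-a - b) * x))
      (fun x : ℝ => Complex.exp (-(b * x)) * Complex.exp (-(a * |x| : ℝ))) (Ioi 0) := by
    intro x hx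
    simp only [← Complex.exp_add, abs_of_pos (show 0 < x from hx)]
    push_cast
    ring_nf
  have hlre : 0 < ((a : ℂ) - b).re := by simpa [hbre] using ha
  have hrre : (-(a : ℂ) - b).re < 0 := by simpa [hbre] using ha
  calc 𝓕 (fun x : ℝ => Complex.exp (-(a * |x| : ℝ))) w
      = ∫ x : ℝ, Complex.exp (-(b * x)) * Complex.exp (-(a * |x| : ℝ)) := by
        rw [Real.fourier_eq']
        refine integral_congr_ae (Filter.Eventually.of_forall fun x => ?_)
        simp only [smul_eq_mul, hb, RCLike.inner_apply, conj_trivial]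
        push_cast
        ring_nf
    _ = 1 / (a - b) + -1 / (-a - b) := by
        rw [← intervalIntegral.integral_Iic_add_Ioi
          ((integrableOn_exp_mul_complex_Iic hlre 0).congr_fun hleft measurableSet_Iic)
          ((integrableOn_exp_mul_complex_Ioi hrre 0).congr_fun hright measurableSet_Ioi),
          ← setIntegral_congr_fun measurableSet_Iic hleft,
          ← setIntegral_congr_fun measurableSet_Ioi hright,
          integral_exp_mul_complex_Iic hlre, integral_exp_mul_complex_Ioi hrre]
        simp
    _ = _ := by
        have h1 : (a : ℂ) - b ≠ 0 := fun h => by simp [h] at hlre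
        have h2 : -(a : ℂ) - b ≠ 0 := fun h => by simp [h] at hrre
        have h3 : ((a ^ 2 + (2 * Real.pi * w) ^ 2 : ℝ) : ℂ) = -((a - b) * (-a - b)) := by
          push_cast
          rw [hb]
          linear_combination ((2 * Real.pi * w : ℂ) ^ 2) * Complex.I_sq
        rw [h3]
        field_simp
        ring

theorem integral_exp_mul_inv_add_sq {a : ℝ} (ha : 0 < a) (r : ℝ) :
    ∫ η : ℝ, Complex.exp (Complex.I * η * r) * (((a ^ 2 + η ^ 2 : ℝ) : ℂ))⁻¹
      = Real.pi / a * Complex.exp (-(a * |r| : ℝ)) := by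
  have hF : 𝓕 (fun x : ℝ => Complex.exp (-(a * |x| : ℝ)))
      = fun w : ℝ => 2 * a * (((a ^ 2 + (2 * Real.pi * w) ^ 2 : ℝ) : ℂ))⁻¹ :=
    funext (fourier_exp_neg_mul_abs ha)
  have hFi : Integrable (𝓕 (fun x : ℝ => Complex.exp (-(a * |x| : ℝ)))) := by
    rw [hF]
    exact ((integrable_inv_add_sq ha).comp_mul_left' (by positivity)).const_mul _
  have h := (integrable_exp_neg_mul_abs ha).fourierInv_fourier_eq hFi (v := r) (by fun_prop)
  rw [hF, Real.fourierInv_eq'] at h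
  have hsub := Measure.integral_comp_mul_left (fun η : ℝ =>
    Complex.exp (Complex.I * η * r) * (((a ^ 2 + η ^ 2 : ℝ) : ℂ))⁻¹) (2 * Real.pi)
  have hint : ∫ v : ℝ, Complex.exp (((2 * Real.pi * inner ℝ v r : ℝ) : ℂ) * Complex.I) •
        (2 * a * (((a ^ 2 + (2 * Real.pi * v) ^ 2 : ℝ) : ℂ))⁻¹)
      = 2 * a * ∫ v : ℝ, Complex.exp (Complex.I * (2 * Real.pi * v : ℝ) * r) *
        (((a ^ 2 + (2 * Real.pi * v) ^ 2 : ℝ) : ℂ))⁻¹ := by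
    rw [← integral_const_mul]
    refine integral_congr_ae (Filter.Eventually.of_forall fun v => ?_)
    simp only [smul_eq_mul, RCLike.inner_apply, conj_trivial]
    push_cast
    ring_nf
  rw [hint, hsub, abs_of_pos (by positivity), Complex.real_smul] at h
  have hpi : (Real.pi : ℂ) ≠ 0 := by exact_mod_cast Real.pi_ne_zero
  have ha' : (a : ℂ) ≠ 0 := by exact_mod_cast ha.ne'
  rw [← h]
  generalize ∫ η : ℝ, Complex.exp (Complex.I * η * r) * (((a ^ 2 + η ^ 2 : ℝ) : ℂ))⁻¹ = J
  push_cast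
  field_simp

theorem integrable_one_add_sq_cpow_neg {s : ℂ} (hs : 1 / 2 < s.re) :
    Integrable (fun η : ℝ => ((1 + η ^ 2 : ℝ) : ℂ) ^ (-s)) := by
  have h : Integrable (fun η : ℝ => (1 + ‖η‖ ^ 2) ^ (-(2 * s.re) / 2)) :=
    integrable_rpow_neg_one_add_norm_sq (by simp; linarith)
  refine h.mono' (by apply Measurable.aestronglyMeasurable; fun_prop)
    (Filter.Eventually.of_forall fun η => ?_)
  rw [Complex.norm_cpow_eq_rpow_re_of_pos (by positivity)]
  apply le_of_eq
  rw [Real.norm_eq_abs, sq_abs, Complex.neg_re]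
  congr 1
  ring

theorem integral_norm_cpow_neg_div_add {s : ℂ} {A : ℝ} (hs0 : 0 < s.re) (hs1 : s.re < 1)
    (hA : 0 < A) :
    ∫ v : ℝ in Ioi 0, ‖(v : ℂ) ^ (-s) / (v + A)‖
      = ((A : ℂ) ^ (-(s.re : ℂ)) *
        (Complex.Gamma s.re * Complex.Gamma (1 - s.re))).re := by
  rw [← integral_cpow_neg_div_add (by simpa) (by simpa) hA]
  have h : ∀ v ∈ Ioi (0 : ℝ), (v : ℂ) ^ (-(s.re : ℂ)) / (v + A)
      = ((‖(v : ℂ) ^ (-s) / (v + A)‖ : ℝ) : ℂ) := by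
    intro v hv
    have hv' : 0 < v := hv
    rw [norm_div, Complex.norm_cpow_eq_rpow_re_of_pos hv', ← Complex.ofReal_add,
      Complex.norm_of_nonneg (by positivity), Complex.ofReal_div, Complex.ofReal_cpow hv'.le]
    simp
  rw [setIntegral_congr_fun measurableSet_Ioi h, integral_complex_ofReal, Complex.ofReal_re]

theorem integrable_exp_mul_cpow_neg_div {s : ℂ} (hs : 1 / 2 < s.re) (hs1 : s.re < 1) (r : ℝ) :
    Integrable (fun p : ℝ × ℝ => Complex.exp (Complex.I * p.1 * r) *
      ((p.2 : ℂ) ^ (-s) / (p.2 + (1 + p.1 ^ 2 : ℝ))))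
      ((volume : Measure ℝ).prod (volume.restrict (Ioi 0))) := by
  have hs0 : 0 < s.re := by linarith
  rw [integrable_prod_iff (by apply Measurable.aestronglyMeasurable; fun_prop)]
  constructor
  · exact Filter.Eventually.of_forall fun η =>
      (integrableOn_cpow_neg_div_add hs0 hs1
        (show 0 < 1 + η ^ 2 by positivity)).const_mul (Complex.exp (Complex.I * η * r))
  · have h := ((integrable_one_add_sq_cpow_neg (s := s.re) hs).mul_const
      (Complex.Gamma s.re * Complex.Gamma (1 - s.re))).re
    refine h.congr (Filter.Eventually.of_forall fun η => ?_)
    have hexp : ‖Complex.exp (Complex.I * η * r)‖ = 1 := by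
      rw [Complex.norm_exp]
      simp
    simp only [norm_mul, hexp, one_mul]
    exact (integral_norm_cpow_neg_div_add hs0 hs1 (by positivity)).symm

theorem integral_exp_mul_cpow_neg_div (s : ℂ) (r : ℝ) {v : ℝ} (hv : 0 < v) :
    ∫ η : ℝ, Complex.exp (Complex.I * η * r) * ((v : ℂ) ^ (-s) / (v + (1 + η ^ 2 : ℝ)))
      = (v : ℂ) ^ (-s) *
        (Real.pi / Real.sqrt (1 + v) * Complex.exp (-(Real.sqrt (1 + v) * |r| : ℝ))) := by
  rw [← integral_exp_mul_inv_add_sq (Real.sqrt_pos.2 (by positivity)), ← integral_const_mul]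
  refine integral_congr_ae (Filter.Eventually.of_forall fun η => ?_)
  simp only
  rw [Real.sq_sqrt (by positivity)]
  push_cast
  ring_nf

theorem image_two_mul_add_sq_Ioi : (fun τ : ℝ => 2 * τ + τ ^ 2) '' Ioi 0 = Ioi 0 := by
  ext v
  constructor
  · rintro ⟨τ, hτ, rfl⟩
    have : 0 < τ := hτ
    exact show (0 : ℝ) < 2 * τ + τ ^ 2 by positivity
  · intro hv
    have hv' : 0 < v := hv
    refine ⟨Real.sqrt (1 + v) - 1, ?_, ?_⟩
    · exact show 0 < Real.sqrt (1 + v) - 1 by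
        rw [sub_pos, Real.lt_sqrt zero_le_one]
        linarith
    · have := Real.sq_sqrt (show 0 ≤ 1 + v by positivity)
      simp only
      linear_combination this

theorem injOn_two_mul_add_sq_Ioi : InjOn (fun τ : ℝ => 2 * τ + τ ^ 2) (Ioi 0) := by
  intro x hx y hy hxy
  have hx' : 0 < x := hx
  have hy' : 0 < y := hy
  have h : (x - y) * (2 + x + y) = 0 := by
    simp only at hxy
    linear_combination hxy
  rcases mul_eq_zero.1 h with h | h <;> linarith

theorem abs_smul_comp_two_mul_add_sq (s : ℂ) (r : ℝ) {τ : ℝ} (hτ : 0 < τ) :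
    |2 + 2 * τ| • (((2 * τ + τ ^ 2 : ℝ) : ℂ) ^ (-s) *
        (Real.pi / Real.sqrt (1 + (2 * τ + τ ^ 2)) *
          Complex.exp (-(Real.sqrt (1 + (2 * τ + τ ^ 2)) * |r| : ℝ))))
      = 2 * Real.pi * Complex.exp (-((|r| : ℝ) : ℂ)) / (2 : ℂ) ^ s *
        (Complex.exp (-((|r| : ℝ) : ℂ) * τ) * ((τ : ℂ) + (τ : ℂ) ^ 2 / 2) ^ (-s)) := by
  have hsqrt : Real.sqrt (1 + (2 * τ + τ ^ 2)) = 1 + τ := by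
    rw [show 1 + (2 * τ + τ ^ 2) = (1 + τ) ^ 2 by ring]
    exact Real.sqrt_sq (by positivity)
  have hpow : ((2 * τ + τ ^ 2 : ℝ) : ℂ) ^ (-s)
      = ((2 : ℂ) ^ s)⁻¹ * ((τ : ℂ) + (τ : ℂ) ^ 2 / 2) ^ (-s) := by
    have h := Complex.mul_cpow_ofReal_nonneg (a := 2) (b := τ + τ ^ 2 / 2) (by norm_num)
      (by positivity) (-s)
    rw [← Complex.ofReal_mul, show 2 * (τ + τ ^ 2 / 2) = 2 * τ + τ ^ 2 by ring] at h
    rw [h, ← Complex.cpow_neg]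
    push_cast
    rfl
  have hexp : Complex.exp (-(((1 + τ) * |r| : ℝ) : ℂ))
      = Complex.exp (-((|r| : ℝ) : ℂ)) * Complex.exp (-((|r| : ℝ) : ℂ) * τ) := by
    rw [← Complex.exp_add]
    push_cast
    ring_nf
  have hne : ((1 + τ : ℝ) : ℂ) ≠ 0 := by
    exact_mod_cast (by positivity : 1 + τ ≠ 0)
  rw [hsqrt, hpow, hexp, abs_of_pos (by positivity), Complex.real_smul,
    show 2 + 2 * τ = 2 * (1 + τ) by ring, Complex.ofReal_mul, Complex.ofReal_ofNat]
  field_simp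

/-- The Bessel-potential formula: for `1 < Re z < 2` and `r ≠ 0`,
`∫ (1+η²)^{-z/2} e^{iηr} dη = 2π e^{-|r|} / (2^{z/2} Γ(z/2) Γ(1-z/2)) ∫₀^∞ e^{-|r|τ}(τ+τ²/2)^{-z/2} dτ`,
both integrals converging absolutely. -/
theorem bessel_potential_formula (z : ℂ) (hz1 : 1 < z.re) (hz2 : z.re < 2)
    (r : ℝ) (hr : r ≠ 0) :
    Integrable (fun η : ℝ =>
        ((1 : ℂ) + (η : ℂ) ^ 2) ^ (-z / 2) * Complex.exp (Complex.I * η * r)) ∧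
    IntegrableOn (fun τ : ℝ =>
        Complex.exp (-((|r| : ℝ) : ℂ) * τ) * (((τ : ℂ) + (τ : ℂ) ^ 2 / 2) ^ (-z / 2)))
      (Set.Ioi (0 : ℝ)) ∧
    (∫ η : ℝ, ((1 : ℂ) + (η : ℂ) ^ 2) ^ (-z / 2) * Complex.exp (Complex.I * η * r))
      = (2 * (Real.pi : ℂ) * Complex.exp (-((|r| : ℝ) : ℂ))) /
          ((2 : ℂ) ^ (z / 2) * Complex.Gamma (z / 2) * Complex.Gamma (1 - z / 2)) *
        ∫ τ in Set.Ioi (0 : ℝ),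
          Complex.exp (-((|r| : ℝ) : ℂ) * τ) * (((τ : ℂ) + (τ : ℂ) ^ 2 / 2) ^ (-z / 2)) := by
  obtain ⟨s, rfl⟩ : ∃ s : ℂ, z = 2 * s := ⟨z / 2, by ring⟩
  have hs : 1 / 2 < s.re := by simp at hz1; linarith
  have hs1 : s.re < 1 := by simp at hz2; linarith
  have hs0 : 0 < s.re := by linarith
  have hcast : ∀ η : ℝ, (1 : ℂ) + (η : ℂ) ^ 2 = ((1 + η ^ 2 : ℝ) : ℂ) := fun η => by push_cast; rfl
  have hneg : -(2 * s) / 2 = -s := by ring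
  have hhalf : 2 * s / 2 = s := by ring
  simp only [hneg, hhalf, hcast]
  have hkernel := integrable_exp_mul_cpow_neg_div hs hs1 r
  have hg : IntegrableOn (fun v : ℝ => (v : ℂ) ^ (-s) *
      (Real.pi / Real.sqrt (1 + v) * Complex.exp (-(Real.sqrt (1 + v) * |r| : ℝ)))) (Ioi 0) := by
    refine hkernel.integral_prod_right.congr ?_
    filter_upwards [ae_restrict_mem measurableSet_Ioi] with v hv
    exact integral_exp_mul_cpow_neg_div s r hv
  have hderiv : ∀ τ ∈ Ioi (0 : ℝ),
      HasDerivWithinAt (fun τ : ℝ => 2 * τ + τ ^ 2) (2 + 2 * τ) (Ioi 0) τ := by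
    intro τ _
    have := ((hasDerivAt_id τ).const_mul 2).add (hasDerivAt_pow 2 τ)
    simpa using! this.hasDerivWithinAt
  have hconst : 2 * (Real.pi : ℂ) * Complex.exp (-((|r| : ℝ) : ℂ)) / (2 : ℂ) ^ s ≠ 0 := by
    simp [Complex.exp_ne_zero, Real.pi_ne_zero, Complex.cpow_eq_zero_iff]
  have hGamma : Complex.Gamma s * Complex.Gamma (1 - s) ≠ 0 :=
    mul_ne_zero (Complex.Gamma_ne_zero_of_re_pos hs0)
      (Complex.Gamma_ne_zero_of_re_pos (by simpa using hs1))
  refine ⟨?_, ?_, ?_⟩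
  · refine (integrable_one_add_sq_cpow_neg hs).mul_bdd (c := 1)
      (by apply Measurable.aestronglyMeasurable; fun_prop)
      (Filter.Eventually.of_forall fun η => ?_)
    rw [Complex.norm_exp]
    simp
  · have hcomp := (integrableOn_image_iff_integrableOn_abs_deriv_smul measurableSet_Ioi hderiv
      injOn_two_mul_add_sq_Ioi _).1 (by rwa [image_two_mul_add_sq_Ioi])
    have := hcomp.congr_fun (fun τ hτ => abs_smul_comp_two_mul_add_sq s r hτ) measurableSet_Ioi
    exact (integrable_const_mul_iff (IsUnit.mk0 _ hconst) _).1 this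
  · have hright : ∫ v : ℝ in Ioi 0, (v : ℂ) ^ (-s) *
        (Real.pi / Real.sqrt (1 + v) * Complex.exp (-(Real.sqrt (1 + v) * |r| : ℝ)))
        = 2 * Real.pi * Complex.exp (-((|r| : ℝ) : ℂ)) / (2 : ℂ) ^ s *
          ∫ τ in Ioi (0 : ℝ), Complex.exp (-((|r| : ℝ) : ℂ) * τ) *
            ((τ : ℂ) + (τ : ℂ) ^ 2 / 2) ^ (-s) := by
      rw [← integral_const_mul, ← setIntegral_congr_fun measurableSet_Ioi
        (fun τ hτ => abs_smul_comp_two_mul_add_sq s r hτ),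
        ← integral_image_eq_integral_abs_deriv_smul measurableSet_Ioi hderiv
          injOn_two_mul_add_sq_Ioi (fun v : ℝ => (v : ℂ) ^ (-s) *
          (Real.pi / Real.sqrt (1 + v) * Complex.exp (-(Real.sqrt (1 + v) * |r| : ℝ)))),
        image_two_mul_add_sq_Ioi]
    have hswap := integral_integral_swap (f := fun η v : ℝ => Complex.exp (Complex.I * η * r) *
      ((v : ℂ) ^ (-s) / (v + (1 + η ^ 2 : ℝ)))) hkernel
    rw [setIntegral_congr_fun measurableSet_Ioi
      (fun v hv => integral_exp_mul_cpow_neg_div s r hv), hright] at hswap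
    have hleft : ∫ η : ℝ, ∫ v : ℝ in Ioi 0, Complex.exp (Complex.I * η * r) *
        ((v : ℂ) ^ (-s) / (v + (1 + η ^ 2 : ℝ)))
        = (∫ η : ℝ, ((1 + η ^ 2 : ℝ) : ℂ) ^ (-s) * Complex.exp (Complex.I * η * r)) *
          (Complex.Gamma s * Complex.Gamma (1 - s)) := by
      rw [← integral_mul_const]
      refine integral_congr_ae (Filter.Eventually.of_forall fun η => ?_)
      beta_reduce
      rw [integral_const_mul, integral_cpow_neg_div_add hs0 hs1 (by positivity)]
      ring
    rw [hleft] at hswap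
    rw [eq_div_of_mul_eq hGamma hswap]
    ring
end

section
/- Define $G_z(r)=(z+1)e^{z^2}\int_{-\infty}^{\infty}(1+\eta^2)^{z/2}e^{i\eta r}\,d\eta$ and $H_z(r)=(z+1)e^{z^2}\int_{-\infty}^{\infty}\eta\,(1+\eta^2)^{-1/2+z/2}e^{i\eta r}\,d\eta$. Then for every complex $z$ with $\operatorname{Re} z<-2$ and every $r\in\mathbb{R}$, both defining integrals converge absolutely and $H_z(r)=\frac{-i\,e^{-2z-1}}{z+2}\; r\; G_{z+1}(r)$. -/
open MeasureTheory

theorem norm_one_add_ofReal_sq_cpow (w : ℂ) (x : ℝ) :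
    ‖((1 : ℂ) + (x : ℂ) ^ 2) ^ w‖ = (1 + x ^ 2) ^ w.re := by
  have h : (1 : ℂ) + (x : ℂ) ^ 2 = ((1 + x ^ 2 : ℝ) : ℂ) := by push_cast; rfl
  rw [h, Complex.norm_cpow_eq_rpow_re_of_pos (by positivity)]

theorem one_add_ofReal_sq_mem_slitPlane (x : ℝ) :
    (1 : ℂ) + (x : ℂ) ^ 2 ∈ Complex.slitPlane := by
  have h : (1 : ℂ) + (x : ℂ) ^ 2 = ((1 + x ^ 2 : ℝ) : ℂ) := by push_cast; rfl
  rw [h, Complex.ofReal_mem_slitPlane]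
  positivity

theorem continuous_one_add_ofReal_sq_cpow (w : ℂ) :
    Continuous fun x : ℝ => ((1 : ℂ) + (x : ℂ) ^ 2) ^ w :=
  Continuous.cpow (by fun_prop) continuous_const one_add_ofReal_sq_mem_slitPlane

theorem norm_exp_I_mul_ofReal_mul_ofReal (x r : ℝ) :
    ‖Complex.exp (Complex.I * x * r)‖ = 1 := by
  rw [mul_assoc, ← Complex.ofReal_mul, Complex.norm_exp_I_mul_ofReal]

theorem integrable_one_add_sq_rpow {s : ℝ} (hs : s < -(1 / 2)) :
    Integrable fun x : ℝ => (1 + x ^ 2) ^ s := by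
  have h := integrable_rpow_neg_one_add_norm_sq (E := ℝ) (μ := volume) (r := -2 * s)
    (by rw [Module.finrank_self, Nat.cast_one]; linarith)
  simpa only [Real.norm_eq_abs, sq_abs, neg_mul, neg_neg, ne_eq, OfNat.ofNat_ne_zero,
    not_false_eq_true, mul_div_cancel_left₀] using h

theorem integrable_one_add_sq_cpow_mul_exp {w : ℂ} (hw : w.re < -(1 / 2)) (r : ℝ) :
    Integrable fun x : ℝ =>
      ((1 : ℂ) + (x : ℂ) ^ 2) ^ w * Complex.exp (Complex.I * x * r) := by
  refine (integrable_one_add_sq_rpow hw).mono'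
    ((continuous_one_add_ofReal_sq_cpow w).mul (by fun_prop)).aestronglyMeasurable
    (.of_forall fun x => ?_)
  rw [norm_mul, norm_exp_I_mul_ofReal_mul_ofReal, norm_one_add_ofReal_sq_cpow, mul_one]

theorem integrable_mul_one_add_sq_cpow_mul_exp {w : ℂ} (hw : w.re < -1) (r : ℝ) :
    Integrable fun x : ℝ =>
      (x : ℂ) * ((1 : ℂ) + (x : ℂ) ^ 2) ^ w * Complex.exp (Complex.I * x * r) := by
  refine (integrable_one_add_sq_rpow (s := 1 / 2 + w.re) (by linarith)).mono'
    ((Complex.continuous_ofReal.mul (continuous_one_add_ofReal_sq_cpow w)).mul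
      (by fun_prop)).aestronglyMeasurable
    (.of_forall fun x => ?_)
  rw [norm_mul, norm_mul, norm_exp_I_mul_ofReal_mul_ofReal, norm_one_add_ofReal_sq_cpow, mul_one,
    Complex.norm_real, Real.norm_eq_abs, Real.rpow_add (by positivity), ← Real.sqrt_eq_rpow]
  gcongr
  exact Real.abs_le_sqrt (by linarith)

theorem hasDerivAt_one_add_sq_cpow_mul_exp (w : ℂ) (r x : ℝ) :
    HasDerivAt
      (fun x : ℝ => ((1 : ℂ) + (x : ℂ) ^ 2) ^ w * Complex.exp (Complex.I * x * r))
      (2 * w * ((x : ℂ) * ((1 : ℂ) + (x : ℂ) ^ 2) ^ (w - 1) * Complex.exp (Complex.I * x * r)) +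
        Complex.I * r * (((1 : ℂ) + (x : ℂ) ^ 2) ^ w * Complex.exp (Complex.I * x * r))) x := by
  have hpow := (((hasDerivAt_id (x : ℂ)).pow 2).const_add 1).cpow_const (c := w)
    (one_add_ofReal_sq_mem_slitPlane x)
  have hexp := (((hasDerivAt_id (x : ℂ)).const_mul Complex.I).mul_const (r : ℂ)).cexp
  refine (hpow.mul hexp).comp_ofReal.congr_deriv ?_
  simp only [id, Pi.pow_apply]
  push_cast
  ring

theorem integral_mul_one_add_sq_cpow_mul_exp {w : ℂ} (hw : w.re < -(1 / 2)) (r : ℝ) :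
    2 * w * ∫ x : ℝ, (x : ℂ) * ((1 : ℂ) + (x : ℂ) ^ 2) ^ (w - 1) *
        Complex.exp (Complex.I * x * r) =
      -(Complex.I * r *
        ∫ x : ℝ, ((1 : ℂ) + (x : ℂ) ^ 2) ^ w * Complex.exp (Complex.I * x * r)) := by
  have hF := integrable_one_add_sq_cpow_mul_exp hw r
  have hF' := integrable_mul_one_add_sq_cpow_mul_exp (w := w - 1)
    (by rw [Complex.sub_re, Complex.one_re]; linarith) r
  have h := integral_eq_zero_of_hasDerivAt_of_integrable
    (hasDerivAt_one_add_sq_cpow_mul_exp w r) ((hF'.const_mul _).add (hF.const_mul _)) hF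
  rw [integral_add (hF'.const_mul _) (hF.const_mul _), integral_const_mul,
    integral_const_mul] at h
  exact eq_neg_of_add_eq_zero_left h

/-- The identity `H_z(r) = (-i e^{-2z-1}/(z+2)) r G_{z+1}(r)` for `Re z < -2`, where
`G_w(r) = (w+1) e^{w²} ∫ (1+η²)^{w/2} e^{iηr} dη` and
`H_z(r) = (z+1) e^{z²} ∫ η (1+η²)^{-1/2+z/2} e^{iηr} dη`, both integrals converging
absolutely. -/
theorem H_eq_r_mul_G (z : ℂ) (hz : z.re < -2) (r : ℝ) :
    Integrable (fun η : ℝ =>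
        ((1 : ℂ) + (η : ℂ) ^ 2) ^ ((z + 1) / 2) * Complex.exp (Complex.I * η * r)) ∧
    Integrable (fun η : ℝ =>
        (η : ℂ) * ((1 : ℂ) + (η : ℂ) ^ 2) ^ (-(1 / 2 : ℂ) + z / 2) *
          Complex.exp (Complex.I * η * r)) ∧
    (z + 1) * Complex.exp (z ^ 2) *
        ∫ η : ℝ, (η : ℂ) * ((1 : ℂ) + (η : ℂ) ^ 2) ^ (-(1 / 2 : ℂ) + z / 2) *
          Complex.exp (Complex.I * η * r)
      = (-Complex.I * Complex.exp (-2 * z - 1)) / (z + 2) * (r : ℂ) *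
          (((z + 1) + 1) * Complex.exp ((z + 1) ^ 2) *
            ∫ η : ℝ, ((1 : ℂ) + (η : ℂ) ^ 2) ^ ((z + 1) / 2) *
              Complex.exp (Complex.I * η * r)) := by
  have hre : ((z + 1) / 2).re < -(1 / 2) := by
    rw [Complex.div_ofNat_re, Complex.add_re, Complex.one_re]
    linarith
  have hexponent : -(1 / 2 : ℂ) + z / 2 = (z + 1) / 2 - 1 := by ring
  have hz2 : z + 2 ≠ 0 := fun h => by
    have := congrArg Complex.re h
    simp only [Complex.add_re, Complex.re_ofNat, Complex.zero_re] at this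
    linarith
  have hexp : Complex.exp (z ^ 2) =
      Complex.exp (-2 * z - 1) * Complex.exp ((z + 1) ^ 2) := by
    rw [← Complex.exp_add]
    ring_nf
  have hparts := integral_mul_one_add_sq_cpow_mul_exp hre r
  rw [hexponent]
  refine ⟨integrable_one_add_sq_cpow_mul_exp hre r,
    integrable_mul_one_add_sq_cpow_mul_exp (by rw [Complex.sub_re, Complex.one_re]; linarith) r, ?_⟩
  rw [mul_div_cancel₀ _ two_ne_zero] at hparts
  rw [mul_right_comm, hparts, hexp]
  field_simp
  ring
end

section
/- Define $H_z(r)=(z+1)e^{z^2}\int_{-\infty}^{\infty}\eta\,(1+\eta^2)^{-1/2+z/2}e^{i\eta r}\,d\eta$. Then for every complex $z$ with $-3<\operatorname{Re} z<-1$ and every real $r\ne 0$, $H_z(r)=2\pi i\,(z+1)e^{z^2}\; \frac{e^{-|r|}}{2^{(1-z)/2}\,\Gamma((1-z)/2)\,\Gamma((3+z)/2)}\; r\int_0^\infty e^{-|r|\tau}\big(\tau+\tau^2/2\big)^{(1+z)/2}\,d\tau$, where both integrals converge absolutely. -/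
open MeasureTheory

theorem integral_mul_cexp_mul_gaussian {s : ℝ} (hs : 0 < s) (r : ℝ) :
    ∫ x : ℝ, (x : ℂ) * Complex.exp (Complex.I * r * x) * Complex.exp (-(s : ℂ) * (x : ℂ) ^ 2) =
      Complex.I * r / (2 * s) *
        ((Real.pi / s : ℂ) ^ (1 / 2 : ℂ) * Complex.exp (-(r : ℂ) ^ 2 / (4 * s))) := by
  have hs' : (s : ℂ) ≠ 0 := by exact_mod_cast hs.ne'
  have hre : 0 < (s : ℂ).re := by simpa
  have hnorm (x : ℝ) : ‖Complex.exp (Complex.I * r * x)‖ ≤ 1 := by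
    rw [Complex.norm_exp]; simp
  have hmeas : AEStronglyMeasurable (fun x : ℝ ↦ Complex.exp (Complex.I * r * x)) :=
    Continuous.aestronglyMeasurable (by fun_prop)
  have h₀ : Integrable fun x : ℝ ↦
      Complex.exp (Complex.I * r * x) * Complex.exp (-(s : ℂ) * (x : ℂ) ^ 2) :=
    (integrable_cexp_neg_mul_sq hre).bdd_mul hmeas (.of_forall hnorm)
  have h₁ : Integrable fun x : ℝ ↦
      (x : ℂ) * Complex.exp (Complex.I * r * x) * Complex.exp (-(s : ℂ) * (x : ℂ) ^ 2) :=
    ((integrable_mul_cexp_neg_mul_sq hre).bdd_mul hmeas (.of_forall hnorm)).congr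
      (.of_forall fun x ↦ by ring)
  have hderiv (x : ℝ) : HasDerivAt
      (fun x : ℝ ↦ Complex.exp (Complex.I * r * x) * Complex.exp (-(s : ℂ) * (x : ℂ) ^ 2))
      (Complex.I * r * (Complex.exp (Complex.I * r * x) * Complex.exp (-(s : ℂ) * (x : ℂ) ^ 2)) -
        2 * s * ((x : ℂ) * Complex.exp (Complex.I * r * x) *
          Complex.exp (-(s : ℂ) * (x : ℂ) ^ 2))) x := by
    have h : HasDerivAt
        (fun x : ℂ ↦ Complex.exp (Complex.I * r * x) * Complex.exp (-(s : ℂ) * x ^ 2)) _ (x : ℂ) :=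
      ((hasDerivAt_id (x : ℂ)).const_mul (Complex.I * r)).cexp.mul
        (((hasDerivAt_id (x : ℂ)).pow 2).const_mul (-(s : ℂ))).cexp
    convert! h.comp_ofReal using 1
    simp
    ring
  have h := integral_eq_zero_of_hasDerivAt_of_integrable hderiv
    ((h₀.const_mul _).sub (h₁.const_mul _)) h₀
  rw [integral_sub (h₀.const_mul _) (h₁.const_mul _), integral_const_mul, integral_const_mul,
    fourierIntegral_gaussian hre] at h
  rw [div_mul_eq_mul_div, eq_div_iff (by simpa using hs')]
  linear_combination -h

theorem norm_one_add_sq_cpow (x : ℝ) (w : ℂ) :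
    ‖((1 : ℂ) + (x : ℂ) ^ 2) ^ w‖ = (1 + x ^ 2) ^ w.re := by
  rw [← Complex.norm_cpow_eq_rpow_re_of_pos (by positivity)]
  push_cast; rfl

theorem integrable_mul_one_add_sq_cpow_mul_cexp {w : ℂ} (hw : w.re < -1) (r : ℝ) :
    Integrable fun x : ℝ ↦
      (x : ℂ) * ((1 : ℂ) + (x : ℂ) ^ 2) ^ w * Complex.exp (Complex.I * x * r) := by
  have hslit (x : ℝ) : (1 : ℂ) + (x : ℂ) ^ 2 ∈ Complex.slitPlane := by
    left
    norm_cast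
    positivity
  have hcont : Continuous fun x : ℝ ↦
      (x : ℂ) * ((1 : ℂ) + (x : ℂ) ^ 2) ^ w * Complex.exp (Complex.I * x * r) := by
    refine .mul (.mul (by fun_prop) ?_) (by fun_prop)
    exact .cpow (by fun_prop) continuous_const hslit
  refine (integrable_rpow_neg_one_add_norm_sq (E := ℝ) (r := -2 * w.re - 1) (μ := volume)
    (by simp; linarith)).mono' hcont.aestronglyMeasurable (.of_forall fun x ↦ ?_)
  have hx : 0 < 1 + x ^ 2 := by positivity
  have hexp : ‖Complex.exp (Complex.I * x * r)‖ = 1 := by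
    rw [Complex.norm_exp]; simp
  rw [norm_mul, hexp, mul_one, norm_mul, norm_one_add_sq_cpow, Complex.norm_real]
  calc ‖x‖ * (1 + x ^ 2) ^ w.re ≤ (1 + x ^ 2) ^ (1 / 2 : ℝ) * (1 + x ^ 2) ^ w.re := by
        gcongr
        rw [← Real.sqrt_eq_rpow]
        exact Real.abs_le_sqrt (by linarith)
    _ = _ := by
        rw [← Real.rpow_add hx, Real.norm_eq_abs, sq_abs]
        ring_nf

/-- The subordination formula for `exp (-(c * t))`, by the substitution
`x = t * √u - c / (2 * √u)`. -/
theorem integral_subordination {c t : ℝ} (hc : 0 < c) (ht : 0 < t) :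
    IntegrableOn (fun u : ℝ ↦ u ^ (-1 / 2 : ℝ) * Real.exp (-(c ^ 2 / (4 * u)) - u * t ^ 2))
      (Set.Ioi 0) ∧
    ∫ u in Set.Ioi (0 : ℝ), u ^ (-1 / 2 : ℝ) * Real.exp (-(c ^ 2 / (4 * u)) - u * t ^ 2) =
      √Real.pi * Real.exp (-(c * t)) / t := by
  set w : ℝ → ℝ := fun x ↦ √(x ^ 2 + 2 * c * t) with hw
  have hwpos (x) : 0 < w x := by simp only [hw]; positivity
  have hwsq (x) : w x ^ 2 = x ^ 2 + 2 * c * t := Real.sq_sqrt (by positivity)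
  have hwgt (x) : |x| < w x := Real.lt_sqrt_of_sq_lt (by rw [sq_abs]; nlinarith [mul_pos hc ht])
  have hφ (x) : 0 < x + w x := by linarith [hwgt x, neg_abs_le x]
  set f : ℝ → ℝ := fun x ↦ ((x + w x) / (2 * t)) ^ 2 with hf
  have hfpos (x) : 0 < f x := by have := hφ x; simp only [hf]; positivity
  have hfsqrt (x) : √(f x) = (x + w x) / (2 * t) :=
    Real.sqrt_sq (by have := hφ x; positivity)
  have hinv (x) : t * √(f x) - c / (2 * √(f x)) = x := by
    have := hφ x
    rw [hfsqrt]
    field_simp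
    linear_combination hwsq x
  have hderiv (x) : HasDerivAt f (2 * √(f x) * ((1 + x / w x) / (2 * t))) x := by
    have h1 : HasDerivAt w (x / w x) x := by
      have := (((hasDerivAt_id x).pow 2).add_const (2 * c * t)).sqrt
        (show x ^ 2 + 2 * c * t ≠ 0 by positivity)
      convert! this using 1
      simp [hw]
      field_simp
    have h2 := (((hasDerivAt_id x).add h1).div_const (2 * t)).pow 2
    convert! h2 using 1
    rw [hfsqrt]
    simp
  have himage : f '' Set.univ = Set.Ioi 0 := by
    ext u
    simp only [Set.image_univ, Set.mem_range, Set.mem_Ioi]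
    refine ⟨fun ⟨x, hx⟩ ↦ hx ▸ hfpos x, fun hu ↦ ⟨t * √u - c / (2 * √u), ?_⟩⟩
    have hu' : 0 < √u := by positivity
    have : w (t * √u - c / (2 * √u)) = t * √u + c / (2 * √u) := by
      simp only [hw]
      rw [Real.sqrt_eq_iff_mul_self_eq (by positivity) (by positivity)]
      field_simp
      ring
    simp only [hf]
    rw [this]
    conv_rhs => rw [← Real.sq_sqrt hu.le]
    congr 1
    field_simp
    ring
  have hinj : Set.InjOn f Set.univ := fun x _ y _ h ↦ by rw [← hinv x, ← hinv y, h]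
  have hcomp (x) : |2 * √(f x) * ((1 + x / w x) / (2 * t))| •
      ((f x) ^ (-1 / 2 : ℝ) * Real.exp (-(c ^ 2 / (4 * f x)) - f x * t ^ 2)) =
      Real.exp (-(c * t)) / t * ((1 + x / w x) * Real.exp (-1 * x ^ 2)) := by
    have h1 : 0 ≤ 1 + x / w x := by
      have := hφ x
      have := hwpos x
      rw [one_add_div this.ne']
      apply div_nonneg <;> linarith
    have h2 : (f x) ^ (-1 / 2 : ℝ) = (√(f x))⁻¹ := by
      rw [Real.sqrt_eq_rpow, ← Real.rpow_neg (hfpos x).le]; norm_num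
    have h3 : 0 < √(f x) := by have := hfpos x; positivity
    have h4 : -(c ^ 2 / (4 * f x)) - f x * t ^ 2 = -(c * t) + -1 * x ^ 2 := by
      conv_lhs => rw [← Real.sq_sqrt (hfpos x).le]
      conv_rhs => rw [← hinv x]
      field_simp
      ring
    rw [abs_of_nonneg (by positivity), h2, h4, Real.exp_add, smul_eq_mul]
    field_simp
  have hg := integrable_exp_neg_mul_sq (b := 1) one_pos
  have hg' : Integrable fun x ↦ x / w x * Real.exp (-1 * x ^ 2) := by
    refine hg.bdd_mul (c := 1) (Measurable.aestronglyMeasurable (by fun_prop))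
      (.of_forall fun x ↦ ?_)
    rw [norm_div, Real.norm_eq_abs, Real.norm_of_nonneg (hwpos x).le, div_le_one (hwpos x)]
    exact (hwgt x).le
  have hodd : ∫ x, x / w x * Real.exp (-1 * x ^ 2) = 0 := by
    have := integral_neg_eq_self (fun x ↦ x / w x * Real.exp (-1 * x ^ 2)) volume
    simp only [hw, neg_sq, neg_div, neg_mul, integral_neg] at this ⊢
    linarith
  rw [← himage, integrableOn_image_iff_integrableOn_abs_deriv_smul .univ
    (fun x _ ↦ (hderiv x).hasDerivWithinAt) hinj, integral_image_eq_integral_abs_deriv_smul .univ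
    (fun x _ ↦ (hderiv x).hasDerivWithinAt) hinj]
  simp only [hcomp, integrableOn_univ, Measure.restrict_univ, add_mul, one_mul]
  refine ⟨(hg.add hg').const_mul _, ?_⟩
  rw [integral_const_mul, integral_add hg hg', hodd, integral_gaussian]
  simp
  ring

theorem norm_ofReal_cpow_mul_cexp {s : ℝ} (hs : 0 < s) (w : ℂ) (y : ℝ) :
    ‖(s : ℂ) ^ w * Complex.exp (-(y * s))‖ = s ^ w.re * Real.exp (-(y * s)) := by
  rw [norm_mul, Complex.norm_cpow_eq_rpow_re_of_pos hs, Complex.norm_exp]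
  simp

theorem integrableOn_rpow_mul_exp_neg_mul {p y : ℝ} (hp : -1 < p) (hy : 0 < y) :
    IntegrableOn (fun s : ℝ ↦ s ^ p * Real.exp (-(y * s))) (Set.Ioi 0) := by
  simpa using integrableOn_rpow_mul_exp_neg_mul_rpow hp one_pos hy

theorem Gamma_mul_integral_mul_one_add_sq_cpow {a : ℂ} (ha : 1 < a.re) (r : ℝ) :
    Complex.Gamma a * ∫ x : ℝ, (x : ℂ) * ((1 : ℂ) + (x : ℂ) ^ 2) ^ (-a) *
        Complex.exp (Complex.I * x * r) =
      Complex.I * r * √Real.pi / 2 * ∫ s in Set.Ioi (0 : ℝ),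
        (s : ℂ) ^ (a - 5 / 2) * Complex.exp (-s - (r : ℂ) ^ 2 / (4 * s)) := by
  have ha₀ : 0 < a.re := by linarith
  set F : ℝ → ℝ → ℂ := fun x s ↦ (x : ℂ) * Complex.exp (Complex.I * x * r) *
    ((s : ℂ) ^ (a - 1) * Complex.exp (-((1 + x ^ 2 : ℝ) * s))) with hF
  have hpos (x : ℝ) : 0 < 1 + x ^ 2 := by positivity
  have hexp (x : ℝ) : ‖Complex.exp (Complex.I * x * r)‖ = 1 := by
    rw [Complex.norm_exp]; simp
  have hmeas : Measurable (Function.uncurry F) := by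
    simp only [hF, Function.uncurry_def]
    fun_prop
  have hnorm (x : ℝ) {s : ℝ} (hs : s ∈ Set.Ioi (0 : ℝ)) : ‖F x s‖ =
      |x| * (s ^ (a.re - 1) * Real.exp (-((1 + x ^ 2) * s))) := by
    simp only [hF]
    rw [norm_mul, norm_mul, hexp, norm_ofReal_cpow_mul_cexp hs, Complex.norm_real]
    simp
  have hint : Integrable (Function.uncurry F) (volume.prod (volume.restrict (Set.Ioi 0))) := by
    refine (integrable_prod_iff hmeas.aestronglyMeasurable).2 ⟨.of_forall fun x ↦ ?_, ?_⟩
    · refine ((integrableOn_rpow_mul_exp_neg_mul (p := a.re - 1) (by linarith)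
        (hpos x)).const_mul |x|).mono' (hmeas.of_uncurry_left (x := x)).aestronglyMeasurable ?_
      filter_upwards [ae_restrict_mem measurableSet_Ioi] with s hs
      exact (hnorm x hs).le
    · refine ((integrable_mul_one_add_sq_cpow_mul_cexp (w := -a)
        (by simpa using ha) r).norm.const_mul (Real.Gamma a.re)).congr (.of_forall fun x ↦ ?_)
      simp only [Function.uncurry_apply_pair]
      rw [setIntegral_congr_fun measurableSet_Ioi (fun s hs ↦ hnorm x hs), integral_const_mul,
        Real.integral_rpow_mul_exp_neg_mul_Ioi ha₀ (hpos x), norm_mul, norm_mul, hexp,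
        norm_one_add_sq_cpow, Complex.norm_real, one_div, Real.inv_rpow (hpos x).le,
        Complex.neg_re, Real.rpow_neg (hpos x).le, Real.norm_eq_abs]
      ring
  calc _ = ∫ x : ℝ, ∫ s in Set.Ioi (0 : ℝ), F x s := by
        rw [← integral_const_mul]
        refine integral_congr_ae (.of_forall fun x ↦ ?_)
        simp only [hF]
        rw [integral_const_mul, Complex.integral_cpow_mul_exp_neg_mul_Ioi ha₀ (hpos x), one_div,
          Complex.inv_cpow _ _ (by
            rw [Complex.arg_ofReal_of_nonneg (hpos x).le]
            exact Real.pi_pos.ne), ← Complex.cpow_neg]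
        push_cast
        ring
    _ = ∫ s in Set.Ioi (0 : ℝ), ∫ x : ℝ, F x s := integral_integral_swap hint
    _ = _ := by
        rw [← integral_const_mul]
        refine setIntegral_congr_fun measurableSet_Ioi fun s (hs : 0 < s) ↦ ?_
        have hs' : (s : ℂ) ≠ 0 := by exact_mod_cast hs.ne'
        have h (x : ℝ) : F x s = (s : ℂ) ^ (a - 1) * Complex.exp (-s) *
            ((x : ℂ) * Complex.exp (Complex.I * r * x) *
              Complex.exp (-(s : ℂ) * (x : ℂ) ^ 2)) := by
          simp only [hF]
          rw [show -(((1 + x ^ 2 : ℝ) : ℂ) * s) = -s + -(s : ℂ) * (x : ℂ) ^ 2 by push_cast; ring,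
            Complex.exp_add, show Complex.I * x * r = Complex.I * r * x by ring]
          ring
        simp only [h]
        have h1 : (s : ℂ) ^ (a - 1) = (s : ℂ) ^ (a - 5 / 2) * s * (s : ℂ) ^ (1 / 2 : ℂ) := by
          nth_rewrite 3 [← Complex.cpow_one (s : ℂ)]
          rw [← Complex.cpow_add _ _ hs', ← Complex.cpow_add _ _ hs']
          ring_nf
        have h2 : (Real.pi / s : ℂ) ^ (1 / 2 : ℂ) * (s : ℂ) ^ (1 / 2 : ℂ) = √Real.pi := by
          rw [← Complex.ofReal_div, ← Complex.mul_cpow_ofReal_nonneg (by positivity) hs.le,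
            ← Complex.ofReal_mul, div_mul_cancel₀ _ hs.ne', Real.sqrt_eq_rpow,
            Complex.ofReal_cpow Real.pi_pos.le]
          norm_num
        rw [integral_const_mul, integral_mul_cexp_mul_gaussian hs, h1, ← h2, sub_eq_add_neg (-_),
          Complex.exp_add, neg_div]
        field_simp

theorem integral_one_add_mul_cpow_mul_exp {b : ℂ} (hb : 0 < b.re) {u : ℝ} (hu : 0 < u) :
    ∫ τ in Set.Ioi (0 : ℝ), ((1 + τ : ℝ) : ℂ) * (((τ + τ ^ 2 / 2 : ℝ) : ℂ) ^ (b - 1) *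
        Complex.exp (-((2 * u : ℝ) * (τ + τ ^ 2 / 2 : ℝ)))) =
      (2 : ℂ) ^ (-b) * (u : ℂ) ^ (-b) * Complex.Gamma b := by
  have hderiv (τ : ℝ) : HasDerivAt (fun τ : ℝ ↦ τ + τ ^ 2 / 2) (1 + τ) τ := by
    convert! (hasDerivAt_id τ).add (((hasDerivAt_id τ).pow 2).div_const 2) using 1
    simp
  have hinj : Set.InjOn (fun τ : ℝ ↦ τ + τ ^ 2 / 2) (Set.Ioi 0) := by
    intro x (hx : 0 < x) y (hy : 0 < y) h
    have : (x - y) * (1 + (x + y) / 2) = 0 := by linear_combination h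
    rcases mul_eq_zero.1 this with h | h <;> linarith
  have himage : (fun τ : ℝ ↦ τ + τ ^ 2 / 2) '' Set.Ioi 0 = Set.Ioi 0 := by
    ext v
    simp only [Set.mem_image, Set.mem_Ioi]
    refine ⟨fun ⟨x, hx, h⟩ ↦ h ▸ by positivity, fun hv ↦ ⟨√(1 + 2 * v) - 1, ?_, ?_⟩⟩
    · rw [sub_pos, Real.lt_sqrt zero_le_one]
      linarith
    · linear_combination (1 / 2) * Real.sq_sqrt (show 0 ≤ 1 + 2 * v by linarith)
  have h := integral_image_eq_integral_abs_deriv_smul measurableSet_Ioi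
    (fun τ _ ↦ (hderiv τ).hasDerivWithinAt) hinj
    (fun v : ℝ ↦ (v : ℂ) ^ (b - 1) * Complex.exp (-((2 * u : ℝ) * v)))
  rw [himage, Complex.integral_cpow_mul_exp_neg_mul_Ioi hb (by positivity)] at h
  have h2 : (1 / ((2 * u : ℝ) : ℂ)) ^ b = (2 : ℂ) ^ (-b) * (u : ℂ) ^ (-b) := by
    rw [one_div, Complex.inv_cpow _ _ (by
      rw [Complex.arg_ofReal_of_nonneg (by positivity)]; exact Real.pi_pos.ne), ← Complex.cpow_neg,
      Complex.ofReal_mul, Complex.mul_cpow_ofReal_nonneg zero_le_two hu.le]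
    simp
  rw [← h2, h]
  refine setIntegral_congr_fun measurableSet_Ioi fun τ (hτ : 0 < τ) ↦ ?_
  rw [abs_of_pos (by linarith), Complex.real_smul]

theorem integrableOn_exp_mul_add_sq_cpow {b : ℂ} (hb₀ : 0 < b.re) (hb₁ : b.re < 1) {ρ : ℝ}
    (hρ : 0 < ρ) :
    IntegrableOn (fun τ : ℝ ↦ Complex.exp (-(ρ : ℂ) * τ) *
      ((τ : ℂ) + (τ : ℂ) ^ 2 / 2) ^ (b - 1)) (Set.Ioi 0) := by
  refine (integrableOn_rpow_mul_exp_neg_mul (p := b.re - 1) (by linarith) hρ).mono'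
    (Measurable.aestronglyMeasurable (by fun_prop)) ?_
  filter_upwards [ae_restrict_mem measurableSet_Ioi] with τ (hτ : 0 < τ)
  rw [norm_mul, Complex.norm_exp, mul_comm, show (τ : ℂ) + (τ : ℂ) ^ 2 / 2 =
    ((τ + τ ^ 2 / 2 : ℝ) : ℂ) by push_cast; rfl,
    Complex.norm_cpow_eq_rpow_re_of_pos (by positivity)]
  simp only [Complex.sub_re, Complex.one_re]
  refine mul_le_mul (Real.rpow_le_rpow_of_nonpos hτ ?_ (by linarith)) ?_ (Real.exp_pos _).le
    (by positivity)
  · linarith [sq_nonneg τ]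
  · simp

theorem exp_mul_integral_exp_mul_add_sq_cpow {b : ℂ} (hb₀ : 0 < b.re) (hb₁ : b.re < 1) {ρ : ℝ}
    (hρ : 0 < ρ) :
    √Real.pi * (Complex.exp (-ρ) * ∫ τ in Set.Ioi (0 : ℝ), Complex.exp (-(ρ : ℂ) * τ) *
        ((τ : ℂ) + (τ : ℂ) ^ 2 / 2) ^ (b - 1)) =
      (2 : ℂ) ^ (-b) * Complex.Gamma b * ∫ u in Set.Ioi (0 : ℝ),
        (u : ℂ) ^ (-1 / 2 - b) * Complex.exp (-u - (ρ : ℂ) ^ 2 / (4 * u)) := by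
  set G : ℝ → ℝ → ℝ := fun τ u ↦
    u ^ (-1 / 2 : ℝ) * Real.exp (-(ρ ^ 2 / (4 * u)) - u * (1 + τ) ^ 2) with hG
  set F : ℝ → ℝ → ℂ := fun τ u ↦
    ((1 + τ : ℝ) : ℂ) * ((τ + τ ^ 2 / 2 : ℝ) : ℂ) ^ (b - 1) * (G τ u : ℂ) with hF
  have hmeas : Measurable (Function.uncurry F) := by
    simp only [hF, hG, Function.uncurry_def]
    fun_prop
  have hnorm (τ : ℝ) {u : ℝ} (hu : u ∈ Set.Ioi (0 : ℝ)) : ‖F τ u‖ =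
      ‖((1 + τ : ℝ) : ℂ) * ((τ + τ ^ 2 / 2 : ℝ) : ℂ) ^ (b - 1)‖ * G τ u := by
    have hu : 0 < u := hu
    simp only [hF]
    rw [norm_mul, Complex.norm_real, Real.norm_of_nonneg (r := G τ u) (by positivity)]
  have hcoe {τ : ℝ} (hτ : 0 < τ) (c : ℂ) :
      ((1 + τ : ℝ) : ℂ) * c * (√Real.pi * Real.exp (-(ρ * (1 + τ))) / (1 + τ) : ℝ) =
      √Real.pi * (Complex.exp (-ρ) * (Complex.exp (-(ρ : ℂ) * τ) * c)) := by
    have : (1 + τ : ℂ) ≠ 0 := by exact_mod_cast (by positivity : 1 + τ ≠ 0)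
    rw [← mul_assoc (Complex.exp _), ← Complex.exp_add]
    push_cast
    field_simp
    ring_nf
  have hbase := (integrableOn_exp_mul_add_sq_cpow hb₀ hb₁ hρ).const_mul (Complex.exp (-ρ))
    |>.const_mul (√Real.pi : ℂ)
  have hint : Integrable (Function.uncurry F)
      ((volume.restrict (Set.Ioi 0)).prod (volume.restrict (Set.Ioi 0))) := by
    refine (integrable_prod_iff hmeas.aestronglyMeasurable).2 ⟨?_, ?_⟩
    · filter_upwards [ae_restrict_mem measurableSet_Ioi] with τ (hτ : 0 < τ)
      have : Integrable (fun u ↦ (G τ u : ℂ)) (volume.restrict (Set.Ioi 0)) :=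
        (integral_subordination hρ (by linarith : 0 < 1 + τ)).1.ofReal
      exact this.const_mul (((1 + τ : ℝ) : ℂ) * ((τ + τ ^ 2 / 2 : ℝ) : ℂ) ^ (b - 1))
    · refine hbase.norm.congr ?_
      filter_upwards [ae_restrict_mem measurableSet_Ioi] with τ (hτ : 0 < τ)
      have hτ' : 0 < 1 + τ := by linarith
      simp only [Function.uncurry_apply_pair]
      rw [setIntegral_congr_fun measurableSet_Ioi (fun u hu ↦ hnorm τ hu), integral_const_mul,
        (integral_subordination hρ hτ').2,
        ← Real.norm_of_nonneg (r := √Real.pi * Real.exp (-(ρ * (1 + τ))) / (1 + τ))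
          (by positivity),
        ← Complex.norm_real, ← norm_mul, hcoe hτ]
      push_cast
      rfl
  calc _ = ∫ τ in Set.Ioi (0 : ℝ), ∫ u in Set.Ioi (0 : ℝ), F τ u := by
        rw [← integral_const_mul, ← integral_const_mul]
        refine setIntegral_congr_fun measurableSet_Ioi fun τ (hτ : 0 < τ) ↦ ?_
        simp only [hF]
        rw [integral_const_mul, integral_complex_ofReal,
          (integral_subordination hρ (by linarith : 0 < 1 + τ)).2,
          hcoe hτ]
        push_cast
        rfl
    _ = ∫ u in Set.Ioi (0 : ℝ), ∫ τ in Set.Ioi (0 : ℝ), F τ u := integral_integral_swap hint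
    _ = _ := by
        rw [← integral_const_mul]
        refine setIntegral_congr_fun measurableSet_Ioi fun u (hu : 0 < u) ↦ ?_
        have hu' : (u : ℂ) ≠ 0 := by exact_mod_cast hu.ne'
        have h (τ : ℝ) : F τ u =
            (u : ℂ) ^ (-1 / 2 : ℂ) * Complex.exp (-u - (ρ : ℂ) ^ 2 / (4 * u)) *
              (((1 + τ : ℝ) : ℂ) * (((τ + τ ^ 2 / 2 : ℝ) : ℂ) ^ (b - 1) *
                Complex.exp (-((2 * u : ℝ) * (τ + τ ^ 2 / 2 : ℝ))))) := by
          simp only [hF, hG]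
          have : Complex.exp (-(ρ ^ 2 / (4 * u)) - u * (1 + τ) ^ 2) =
              Complex.exp (-u - (ρ : ℂ) ^ 2 / (4 * u)) *
                Complex.exp (-((2 * u : ℝ) * (τ + τ ^ 2 / 2 : ℝ))) := by
            rw [← Complex.exp_add]
            push_cast
            ring_nf
          rw [Complex.ofReal_mul, Complex.ofReal_cpow hu.le]
          push_cast at this ⊢
          rw [this]
          ring
        simp only [h]
        rw [integral_const_mul, integral_one_add_mul_cpow_mul_exp hb₀ hu, sub_eq_add_neg (_ / _),
          Complex.cpow_add _ _ hu']
        ring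

/-- The closed formula (7.10): for `-3 < Re z < -1` and `r ≠ 0`,
`H_z(r) = 2πi (z+1) e^{z²} e^{-|r|} / (2^{(1-z)/2} Γ((1-z)/2) Γ((3+z)/2)) ·
  r ∫₀^∞ e^{-|r|τ}(τ+τ²/2)^{(1+z)/2} dτ`,
where `H_z(r) = (z+1) e^{z²} ∫ η (1+η²)^{-1/2+z/2} e^{iηr} dη`, both integrals converging
absolutely. -/
theorem H_formula (z : ℂ) (hz1 : -3 < z.re) (hz2 : z.re < -1) (r : ℝ) (hr : r ≠ 0) :
    Integrable (fun η : ℝ =>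
        (η : ℂ) * ((1 : ℂ) + (η : ℂ) ^ 2) ^ (-(1 / 2 : ℂ) + z / 2) *
          Complex.exp (Complex.I * η * r)) ∧
    IntegrableOn (fun τ : ℝ =>
        Complex.exp (-((|r| : ℝ) : ℂ) * τ) * (((τ : ℂ) + (τ : ℂ) ^ 2 / 2) ^ ((1 + z) / 2)))
      (Set.Ioi (0 : ℝ)) ∧
    (z + 1) * Complex.exp (z ^ 2) *
        ∫ η : ℝ, (η : ℂ) * ((1 : ℂ) + (η : ℂ) ^ 2) ^ (-(1 / 2 : ℂ) + z / 2) *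
          Complex.exp (Complex.I * η * r)
      = 2 * (Real.pi : ℂ) * Complex.I * (z + 1) * Complex.exp (z ^ 2) *
          (Complex.exp (-((|r| : ℝ) : ℂ)) /
            ((2 : ℂ) ^ ((1 - z) / 2) * Complex.Gamma ((1 - z) / 2) *
              Complex.Gamma ((3 + z) / 2))) *
          (r : ℂ) *
          ∫ τ in Set.Ioi (0 : ℝ),
            Complex.exp (-((|r| : ℝ) : ℂ) * τ) *
              (((τ : ℂ) + (τ : ℂ) ^ 2 / 2) ^ ((1 + z) / 2)) := by
  have hr' : 0 < |r| := abs_pos.2 hr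
  have ha : 1 < ((1 - z) / 2).re := by simp; linarith
  have hb₀ : 0 < ((3 + z) / 2).re := by simp; linarith
  have hb₁ : ((3 + z) / 2).re < 1 := by simp; linarith
  have hη : -(1 / 2 : ℂ) + z / 2 = -((1 - z) / 2) := by ring
  have hτ : (1 + z) / 2 = (3 + z) / 2 - 1 := by ring
  rw [hη, hτ]
  refine ⟨integrable_mul_one_add_sq_cpow_mul_cexp (by rw [Complex.neg_re]; linarith) r,
    integrableOn_exp_mul_add_sq_cpow hb₀ hb₁ hr', ?_⟩
  have hA := Gamma_mul_integral_mul_one_add_sq_cpow ha r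
  have hB := exp_mul_integral_exp_mul_add_sq_cpow hb₀ hb₁ hr'
  have hsq : ((|r| : ℝ) : ℂ) ^ 2 = (r : ℂ) ^ 2 := by exact_mod_cast sq_abs r
  rw [hsq, show -1 / 2 - (3 + z) / 2 = (1 - z) / 2 - 5 / 2 by ring] at hB
  have hΓa : Complex.Gamma ((1 - z) / 2) ≠ 0 := Complex.Gamma_ne_zero_of_re_pos (by linarith)
  have hΓb : Complex.Gamma ((3 + z) / 2) ≠ 0 := Complex.Gamma_ne_zero_of_re_pos hb₀
  have h2 : (2 : ℂ) ^ ((1 - z) / 2) ≠ 0 := by simp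
  have h4 : (2 : ℂ) ^ (-((3 + z) / 2)) = (2 : ℂ) ^ ((1 - z) / 2) / 4 := by
    rw [show -((3 + z) / 2) = (1 - z) / 2 - (2 : ℕ) by push_cast; ring,
      Complex.cpow_sub _ _ two_ne_zero, Complex.cpow_natCast]
    norm_num
  have hπ : (√Real.pi : ℂ) * √Real.pi = Real.pi := by
    exact_mod_cast Real.mul_self_sqrt Real.pi_pos.le
  rw [h4] at hB
  rw [← hπ]
  generalize (∫ τ in Set.Ioi (0 : ℝ), Complex.exp (-((|r| : ℝ) : ℂ) * τ) *
    ((τ : ℂ) + (τ : ℂ) ^ 2 / 2) ^ ((3 + z) / 2 - 1)) = P at hB ⊢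
  rw [← mul_right_inj' hΓa, mul_left_comm, hA]
  generalize (∫ s in Set.Ioi (0 : ℝ), (s : ℂ) ^ ((1 - z) / 2 - 5 / 2) *
    Complex.exp (-s - (r : ℂ) ^ 2 / (4 * s))) = J at hB ⊢
  field_simp
  linear_combination -4 * (z + 1) * r * hB
end
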